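/- arXiv:2312.07790 — 2 statements merged into one kernel-verified Lean document; each statement's English description precedes it below -/
import Mathlib

section
/- Lévy's inversion theorem: Let μ be a probability measure on ℝ and let φ(t) = ∫ exp(i t x) dμ(x) be its characteristic function. Then for any real numbers a < b, the limit as T → ∞ of (1/(2π)) ∫_{-T}^{T} ((exp(−i t a) − exp(−i t b))/(i t)) φ(t) dt exists and equals μ((a,b)) + (1/2)(μ({a}) + μ({b})). In particular, φ uniquely determines μ. -/
open MeasureTheory Filter Real

/-- The characteristic function of a measure `μ` on `ℝ`:
`φ_μ(t) = ∫ exp(i t x) dμ(x)`. -/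
noncomputable def charFun1 (μ : Measure ℝ) (t : ℝ) : ℂ :=
  ∫ x, Complex.exp (((t * x : ℝ) : ℂ) * Complex.I) ∂μ

/-- The sine integral. -/
noncomputable def levySi (T : ℝ) : ℝ := ∫ t in (0 : ℝ)..T, sinc t

lemma levySi_neg (T : ℝ) : levySi (-T) = -levySi T := by
  unfold levySi
  have h := intervalIntegral.integral_comp_neg (a := 0) (b := T) sinc
  simp only [sinc_neg, neg_zero] at h
  rw [h, intervalIntegral.integral_symm]

lemma levySi_continuous : Continuous levySi :=
  intervalIntegral.continuous_primitive (fun _ _ => continuous_sinc.intervalIntegrable _ _) 0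

lemma levySi_fubini {T : ℝ} (hT : 0 < T) :
    levySi T = ∫ x in Set.Ioi (0 : ℝ), ∫ t in (0 : ℝ)..T, exp (-t * x) * sin t := by
  have h1 : levySi T = ∫ t in (0 : ℝ)..T, ∫ x in Set.Ioi (0 : ℝ), exp (-t * x) * sin t := by
    unfold levySi
    refine intervalIntegral.integral_congr_ae (ae_of_all _ fun t ht => ?_)
    rw [Set.uIoc_of_le hT.le] at ht
    rw [integral_mul_const, integral_exp_mul_Ioi (by linarith [ht.1]), sinc_of_ne_zero ht.1.ne']
    have := ht.1.ne'
    simp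
    field_simp
  rw [h1]
  refine intervalIntegral_integral_swap ?_
  rw [Set.uIoc_of_le hT.le]
  rw [integrable_prod_iff (by
    apply Continuous.aestronglyMeasurable
    simp only [Function.uncurry_def]
    fun_prop)]
  have hae : ∀ᵐ t : ℝ ∂(volume.restrict (Set.Ioc 0 T)), t ∈ Set.Ioc 0 T :=
    ae_restrict_mem measurableSet_Ioc
  constructor
  · filter_upwards [hae] with t ht
    exact (integrableOn_exp_mul_Ioi (neg_neg_of_pos ht.1) 0).mul_const (sin t)
  · have hi : IntegrableOn (fun t : ℝ => |sinc t|) (Set.Ioc 0 T) volume :=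
      (continuous_sinc.abs.integrableOn_Icc).mono_set Set.Ioc_subset_Icc_self
    refine hi.congr ?_
    filter_upwards [hae] with t ht
    simp only [Function.uncurry_def, norm_mul, Real.norm_eq_abs, abs_exp]
    rw [integral_mul_const, integral_exp_mul_Ioi (by linarith [ht.1]), sinc_of_ne_zero ht.1.ne',
      abs_div, abs_of_pos ht.1]
    have := ht.1.ne'
    simp
    field_simp

lemma levySi_inner (T x : ℝ) : ∫ t in (0 : ℝ)..T, exp (-t * x) * sin t =
    (1 + x ^ 2)⁻¹ - exp (-T * x) * (x * sin T + cos T) / (1 + x ^ 2) := by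
  have hx : (1 + x ^ 2) ≠ 0 := by positivity
  have hd : ∀ t ∈ Set.uIcc 0 T, HasDerivAt
      (fun t : ℝ => -(exp (-t * x) * (x * sin t + cos t) / (1 + x ^ 2)))
      (exp (-t * x) * sin t) t := by
    intro t _
    have h1 : HasDerivAt (fun t : ℝ => exp (-t * x)) (exp (-t * x) * (-1 * x)) t :=
      (((hasDerivAt_id t).neg).mul_const x).exp
    have h2 : HasDerivAt (fun t : ℝ => x * sin t + cos t) (x * cos t + -sin t) t :=
      ((hasDerivAt_sin t).const_mul x).add (hasDerivAt_cos t)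
    refine (((h1.mul h2).div_const (1 + x ^ 2)).neg).congr_deriv ?_
    field_simp
    ring
  rw [intervalIntegral.integral_eq_sub_of_hasDerivAt hd
    (Continuous.intervalIntegrable (by fun_prop) _ _)]
  simp
  ring

lemma levySi_sub_le {T : ℝ} (hT : 0 < T) : |levySi T - π / 2| ≤ 2 / T := by
  have hb : ∀ x ∈ Set.Ioi (0 : ℝ),
      ‖exp (-T * x) * (x * sin T + cos T) / (1 + x ^ 2)‖ ≤ 2 * exp (-T * x) := by
    intro x hx
    have hx : 0 < x := hx
    rw [Real.norm_eq_abs, abs_div, abs_mul, abs_exp, abs_of_pos (by positivity : 0 < 1 + x ^ 2),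
      div_le_iff₀ (by positivity)]
    have h1 : |x * sin T + cos T| ≤ x + 1 := by
      refine (abs_add_le _ _).trans ?_
      rw [abs_mul, abs_of_pos hx]
      have := abs_sin_le_one T
      have := abs_cos_le_one T
      nlinarith
    have h2 : x + 1 ≤ 2 * (1 + x ^ 2) := by nlinarith [sq_nonneg (x - 1)]
    have := exp_pos (-T * x)
    calc _ ≤ exp (-T * x) * (2 * (1 + x ^ 2)) := by gcongr; exact h1.trans h2
      _ = _ := by ring
  have hi2 : IntegrableOn (fun x => 2 * exp (-T * x)) (Set.Ioi 0) volume :=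
    (integrableOn_exp_mul_Ioi (by linarith) 0).const_mul 2
  have hb' := (ae_restrict_iff' (μ := volume) measurableSet_Ioi).2 (ae_of_all _ hb)
  have hi : IntegrableOn (fun x => exp (-T * x) * (x * sin T + cos T) / (1 + x ^ 2))
      (Set.Ioi 0) volume := by
    refine Integrable.mono' hi2 (Measurable.aestronglyMeasurable (by fun_prop)) hb'
  rw [levySi_fubini hT]
  simp_rw [levySi_inner]
  rw [integral_sub integrable_inv_one_add_sq.integrableOn hi, integral_Ioi_inv_one_add_sq]
  rw [arctan_zero, sub_zero, sub_sub_cancel_left, abs_neg]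
  refine (norm_integral_le_of_norm_le hi2 hb').trans (le_of_eq ?_)
  rw [integral_const_mul, integral_exp_mul_Ioi (by linarith)]
  simp
  field_simp

lemma levySi_tendsto : Tendsto levySi atTop (nhds (π / 2)) := by
  rw [tendsto_iff_norm_sub_tendsto_zero]
  refine squeeze_zero' (Eventually.of_forall fun _ => norm_nonneg _) ?_
    (tendsto_const_nhds.div_atTop tendsto_id : Tendsto (fun T : ℝ => 2 / T) atTop (nhds 0))
  filter_upwards [eventually_gt_atTop 0] with T hT using levySi_sub_le hT

lemma levySi_bound (T : ℝ) : |levySi T| ≤ 4 := by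
  have key : ∀ T : ℝ, 0 ≤ T → |levySi T| ≤ 4 := by
    intro T hT
    rcases le_total T 1 with h | h
    · have := intervalIntegral.norm_integral_le_of_norm_le_const (a := 0) (b := T) (f := sinc)
        (C := 1) (fun x _ => abs_sinc_le_one x)
      rw [sub_zero, abs_of_nonneg hT, Real.norm_eq_abs] at this
      unfold levySi
      linarith
    · have h1 := levySi_sub_le (by linarith : 0 < T)
      have h2 : 2 / T ≤ 2 := by rw [div_le_iff₀ (by linarith)]; linarith
      have h3 := pi_le_four
      have h4 := pi_pos
      rw [abs_le] at h1 ⊢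
      constructor <;> linarith
  rcases le_total 0 T with h | h
  · exact key T h
  · have := key (-T) (by linarith)
    rwa [levySi_neg, abs_neg] at this

lemma levySi_scaled (c : ℝ) :
    Tendsto (fun T : ℝ => levySi (c * T)) atTop (nhds (SignType.sign c * (π / 2))) := by
  rcases lt_trichotomy c 0 with h | rfl | h
  · have h1 : Tendsto (fun T : ℝ => -levySi (-c * T)) atTop (nhds (-(π / 2))) :=
      (levySi_tendsto.comp (tendsto_id.const_mul_atTop (by linarith))).neg
    simp only [neg_mul, levySi_neg, neg_neg] at h1
    simpa [sign_neg h] using h1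
  · simp [levySi]
  · have h1 : Tendsto (fun T : ℝ => levySi (c * T)) atTop (nhds (π / 2)) :=
      levySi_tendsto.comp (tendsto_id.const_mul_atTop h)
    simpa [sign_pos h] using h1

/-- The kernel appearing in the inversion formula. -/
noncomputable def levyK (a b t x : ℝ) : ℂ :=
  ((Complex.exp (-(((t * a : ℝ) : ℂ) * Complex.I)) -
    Complex.exp (-(((t * b : ℝ) : ℂ) * Complex.I))) /
    (Complex.I * (t : ℂ))) * Complex.exp (((t * x : ℝ) : ℂ) * Complex.I)

lemma levyK_eq (a b t x : ℝ) : levyK a b t x =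
    (((cos ((x - a) * t) - cos ((x - b) * t) : ℝ) : ℂ) +
      ((sin ((x - a) * t) - sin ((x - b) * t) : ℝ) : ℂ) * Complex.I) / (Complex.I * (t : ℂ)) := by
  have h : ∀ c : ℝ, Complex.exp (-(((t * c : ℝ) : ℂ) * Complex.I)) *
      Complex.exp (((t * x : ℝ) : ℂ) * Complex.I) =
      ((cos ((x - c) * t) : ℝ) : ℂ) + ((sin ((x - c) * t) : ℝ) : ℂ) * Complex.I := by
    intro c
    rw [← Complex.exp_add, Complex.ofReal_cos, Complex.ofReal_sin, ← Complex.exp_mul_I]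
    congr 1
    push_cast
    ring
  unfold levyK
  rw [div_mul_eq_mul_div, sub_mul, h a, h b]
  push_cast
  ring

lemma levyK_measurable (a b : ℝ) : Measurable (Function.uncurry (levyK a b)) := by
  unfold levyK
  simp only [Function.uncurry_def]
  fun_prop

lemma levyK_norm_le (a b t x : ℝ) : ‖levyK a b t x‖ ≤ |b - a| := by
  unfold levyK
  rw [norm_mul, Complex.norm_exp_ofReal_mul_I, mul_one, norm_div, norm_mul, Complex.norm_I,
    one_mul, Complex.norm_real, Real.norm_eq_abs]
  refine div_le_of_le_mul₀ (abs_nonneg _) (abs_nonneg _) ?_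
  have h : Complex.exp (-(((t * a : ℝ) : ℂ) * Complex.I)) -
      Complex.exp (-(((t * b : ℝ) : ℂ) * Complex.I)) =
      Complex.exp (((-(t * b) : ℝ) : ℂ) * Complex.I) *
        (Complex.exp (Complex.I * ((t * (b - a) : ℝ) : ℂ)) - 1) := by
    rw [mul_sub, ← Complex.exp_add, mul_one]
    congr 2 <;> (push_cast; ring)
  rw [h, norm_mul, Complex.norm_exp_ofReal_mul_I, one_mul]
  refine Real.norm_exp_I_mul_ofReal_sub_one_le.trans (le_of_eq ?_)
  rw [Real.norm_eq_abs, abs_mul, mul_comm]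

lemma mul_sinc_mul (c : ℝ) {t : ℝ} (ht : t ≠ 0) : c * sinc (c * t) = sin (c * t) / t := by
  by_cases hc : c = 0
  · simp [hc]
  · rw [sinc_of_ne_zero (mul_ne_zero hc ht)]
    field_simp

lemma levyK_intervalIntegrable (a b x u v : ℝ) :
    IntervalIntegrable (fun t => levyK a b t x) volume u v := by
  refine (intervalIntegrable_const (c := |b - a|)).mono_fun ?_ ?_
  · exact ((levyK_measurable a b).comp (measurable_id.prodMk measurable_const)).aestronglyMeasurable
  · refine ae_of_all _ fun t => ?_
    simpa using levyK_norm_le a b t x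

lemma levyK_integral (a b x : ℝ) {T : ℝ} (hT : 0 < T) :
    ∫ t in (-T)..T, levyK a b t x =
      ((2 * (levySi ((x - a) * T) - levySi ((x - b) * T)) : ℝ) : ℂ) := by
  have h0 := intervalIntegral.integral_comp_neg (a := 0) (b := T) (fun t => levyK a b t x)
  rw [neg_zero] at h0
  have hi : IntervalIntegrable (fun t => levyK a b (-t) x) volume 0 T := by
    have := levyK_intervalIntegrable a b x (-0) (-T)
    refine (intervalIntegrable_const (c := |b - a|)).mono_fun ?_ ?_
    · exact ((levyK_measurable a b).comp
        (measurable_neg.prodMk measurable_const)).aestronglyMeasurable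
    · refine ae_of_all _ fun t => ?_
      simpa using levyK_norm_le a b (-t) x
  rw [← intervalIntegral.integral_add_adjacent_intervals
    (levyK_intervalIntegrable a b x (-T) 0) (levyK_intervalIntegrable a b x 0 T), ← h0,
    ← intervalIntegral.integral_add hi (levyK_intervalIntegrable a b x 0 T)]
  have h1 : ∀ c : ℝ, levySi (c * T) = ∫ t in (0 : ℝ)..T, c * sinc (c * t) := by
    intro c
    rw [intervalIntegral.integral_const_mul, intervalIntegral.mul_integral_comp_mul_left, mul_zero]
    rfl
  rw [h1, h1, ← intervalIntegral.integral_sub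
    (Continuous.intervalIntegrable (by fun_prop) _ _)
    (Continuous.intervalIntegrable (by fun_prop) _ _), ← intervalIntegral.integral_const_mul,
    ← intervalIntegral.integral_ofReal]
  refine intervalIntegral.integral_congr_ae (ae_of_all _ fun t ht => ?_)
  rw [Set.uIoc_of_le hT.le] at ht
  have ht0 : t ≠ 0 := ht.1.ne'
  have ht1 : (t : ℂ) ≠ 0 := by exact_mod_cast ht0
  rw [mul_sinc_mul _ ht0, mul_sinc_mul _ ht0, levyK_eq, levyK_eq]
  simp only [mul_neg, cos_neg, sin_neg]
  have hI := Complex.I_ne_zero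
  push_cast
  field_simp
  ring

lemma levy_limit (μ : Measure ℝ) [IsProbabilityMeasure μ] (a b : ℝ) (hab : a < b) :
    Tendsto (fun T : ℝ => ∫ x, (1 / (2 * π)) *
      (2 * (levySi ((x - a) * T) - levySi ((x - b) * T))) ∂μ) atTop
      (nhds ((μ (Set.Ioo a b)).toReal + (1 / 2) * ((μ {a}).toReal + (μ {b}).toReal))) := by
  have hg : ∫ x, ((Set.Ioo a b).indicator (fun _ => (1 : ℝ)) x + (1 / 2) *
      (({a} : Set ℝ).indicator (fun _ => (1 : ℝ)) x +
        ({b} : Set ℝ).indicator (fun _ => (1 : ℝ)) x)) ∂μ =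
      (μ (Set.Ioo a b)).toReal + (1 / 2) * ((μ {a}).toReal + (μ {b}).toReal) := by
    have hi : ∀ s : Set ℝ, MeasurableSet s → Integrable (s.indicator (fun _ => (1 : ℝ))) μ :=
      fun s hs => (integrable_const 1).indicator hs
    have ha := hi {a} (measurableSet_singleton a)
    have hb := hi {b} (measurableSet_singleton b)
    have hv : ∀ s : Set ℝ, MeasurableSet s →
        ∫ x, s.indicator (fun _ => (1 : ℝ)) x ∂μ = (μ s).toReal := by
      intro s hs
      rw [integral_indicator_const _ hs]
      simp [Measure.real]
    have hab' : Integrable (fun x => (1 / 2 : ℝ) * (({a} : Set ℝ).indicator (fun _ => (1 : ℝ)) x +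
        ({b} : Set ℝ).indicator (fun _ => (1 : ℝ)) x)) μ := (ha.add hb).const_mul _
    rw [integral_add (hi _ measurableSet_Ioo) hab', integral_const_mul,
      integral_add ha hb, hv _ measurableSet_Ioo, hv _ (measurableSet_singleton a),
      hv _ (measurableSet_singleton b)]
  rw [← hg]
  refine tendsto_integral_filter_of_dominated_convergence
    (fun _ => (1 / (2 * π)) * (2 * (4 + 4))) ?_ ?_ (integrable_const _) ?_
  · refine Eventually.of_forall fun T => Continuous.aestronglyMeasurable ?_
    have := levySi_continuous
    fun_prop
  · refine Eventually.of_forall fun T => ae_of_all _ fun x => ?_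
    have hpi := pi_pos
    rw [norm_mul, norm_mul, Real.norm_of_nonneg (by positivity : 0 ≤ 1 / (2 * π)),
      Real.norm_of_nonneg (by norm_num : (0 : ℝ) ≤ 2)]
    gcongr
    exact (norm_sub_le _ _).trans (add_le_add (levySi_bound _) (levySi_bound _))
  · refine ae_of_all _ fun x => ?_
    have h := (((levySi_scaled (x - a)).sub (levySi_scaled (x - b))).const_mul 2).const_mul
      (1 / (2 * π))
    convert h using 2
    have hpi := pi_pos.ne'
    rcases lt_trichotomy x a with h1 | rfl | h1
    · have h2 : x < b := h1.trans hab
      simp [sign_neg (sub_neg.2 h1), sign_neg (sub_neg.2 h2), h1.ne, h2.ne, h1.not_gt]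
    · simp [sign_neg (sub_neg.2 hab), hab.ne]
      field_simp
    · rcases lt_trichotomy x b with h2 | rfl | h2
      · simp [sign_pos (sub_pos.2 h1), sign_neg (sub_neg.2 h2), h1.ne', h2.ne, h1, h2]
        field_simp
      · simp [sign_pos (sub_pos.2 h1), h1.ne']
        field_simp
      · simp [sign_pos (sub_pos.2 h1), sign_pos (sub_pos.2 h2), h1.ne', h2.ne', h2.not_gt]

/-- Lévy's inversion theorem. -/
theorem levy_inversion (μ : Measure ℝ) [IsProbabilityMeasure μ] :
    (∀ a b : ℝ, a < b →
      Tendsto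
        (fun T : ℝ =>
          (1 / (2 * Real.pi) : ℂ) *
            ∫ t in (-T)..T,
              ((Complex.exp (-(((t * a : ℝ) : ℂ) * Complex.I)) -
                  Complex.exp (-(((t * b : ℝ) : ℂ) * Complex.I))) /
                  (Complex.I * (t : ℂ))) * charFun1 μ t)
        atTop
        (nhds (((μ (Set.Ioo a b)).toReal +
            (1 / 2) * ((μ {a}).toReal + (μ {b}).toReal) : ℝ) : ℂ))) ∧
    (∀ ν : Measure ℝ, IsProbabilityMeasure ν →
      (∀ t : ℝ, charFun1 ν t = charFun1 μ t) → ν = μ) := by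
  refine ⟨fun a b hab => ?_, fun ν hν h => ?_⟩
  · have h := (Complex.continuous_ofReal.tendsto _).comp (levy_limit μ a b hab)
    refine h.congr' ?_
    filter_upwards [eventually_gt_atTop 0] with T hT
    have hsw : ∫ t in (-T)..T, ∫ x, levyK a b t x ∂μ =
        ∫ x, (∫ t in (-T)..T, levyK a b t x) ∂μ := by
      refine intervalIntegral_integral_swap ?_
      refine Integrable.mono' (g := fun _ => |b - a|) ?_
        (levyK_measurable a b).aestronglyMeasurable
        (ae_of_all _ fun p => levyK_norm_le a b p.1 p.2)
      rw [Set.uIoc_of_le (by linarith)]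
      exact integrable_const _
    have hl : ∀ t : ℝ, ((Complex.exp (-(((t * a : ℝ) : ℂ) * Complex.I)) -
        Complex.exp (-(((t * b : ℝ) : ℂ) * Complex.I))) /
        (Complex.I * (t : ℂ))) * charFun1 μ t = ∫ x, levyK a b t x ∂μ := by
      intro t
      unfold charFun1 levyK
      rw [integral_const_mul]
    simp_rw [hl]
    rw [hsw]
    simp_rw [levyK_integral a b _ hT]
    rw [integral_complex_ofReal, Function.comp_apply, integral_const_mul]
    push_cast
    rfl
  · refine Measure.ext_of_charFun ?_
    funext t
    rw [charFun_apply_real, charFun_apply_real]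
    have := h t
    unfold charFun1 at this
    push_cast at this
    exact this
end

section
/- If μ is a probability measure on ℝ whose characteristic function φ satisfies ∫_ℝ |φ(t)| dt < ∞, then μ is absolutely continuous with respect to Lebesgue measure with a continuous probability density function f given by f(x) = (1/(2π)) ∫_ℝ exp(−i t x) φ(t) dt. -/
open MeasureTheory Real

open scoped FourierTransform SchwartzMap Topology

/-- Rescaled characteristic function. -/
noncomputable def scaledCF (μ : Measure ℝ) (ξ : ℝ) : ℂ := charFun1 μ (2 * π * ξ)

lemma scaledCF_eq (μ : Measure ℝ) (ξ : ℝ) :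
    scaledCF μ ξ = VectorFourier.fourierIntegral 𝐞 μ (-innerₗ ℝ) (fun _ => (1 : ℂ)) ξ := by
  unfold scaledCF charFun1 VectorFourier.fourierIntegral
  congr 1 with x
  simp [Circle.smul_def, Real.fourierChar_apply]
  ring_nf

lemma scaledCF_integrable (μ : Measure ℝ)
    (hint : Integrable (fun t => charFun1 μ t) volume) : Integrable (scaledCF μ) :=
  hint.comp_mul_left' (R := 2 * π) (by positivity)

/-- The inverse Fourier integral. -/
lemma fourier_scaledCF (μ : Measure ℝ) (x : ℝ) :
    𝓕 (scaledCF μ) x = (1 / (2 * Real.pi) : ℂ) *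
      ∫ t : ℝ, Complex.exp (-(((t * x : ℝ) : ℂ) * Complex.I)) * charFun1 μ t := by
  have h := Measure.integral_comp_mul_left
    (fun t : ℝ => Complex.exp (-(((t * x : ℝ) : ℂ) * Complex.I)) * charFun1 μ t) (2 * π)
  rw [fourier_real_eq_integral_exp_smul]
  have h2 : (1 / (2 * Real.pi) : ℂ) = ((|(2 * π)⁻¹| : ℝ) : ℂ) := by
    rw [abs_of_nonneg (by positivity)]; push_cast; simp
  rw [h2, ← Complex.real_smul, ← h]
  congr 1 with v
  simp only [smul_eq_mul, scaledCF]
  congr 2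
  push_cast
  ring

lemma parseval_schwartz (μ : Measure ℝ) [IsProbabilityMeasure μ]
    (hint : Integrable (fun t => charFun1 μ t) volume) (g : 𝓢(ℝ, ℂ)) :
    ∫ x, g x ∂μ = ∫ x, g x * 𝓕 (scaledCF μ) x := by
  have hFg : Integrable (𝓕 (g : ℝ → ℂ)) := by
    rw [← SchwartzMap.fourier_coe]; exact (𝓕 g).integrable
  have hinv : 𝓕⁻ (𝓕 (g : ℝ → ℂ)) = g :=
    g.continuous.fourierInv_fourier_eq g.integrable hFg
  have e1 := VectorFourier.integral_fourierIntegral_smul_eq_flip (μ := μ) (ν := volume)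
    (L := -innerₗ ℝ) (f := fun _ => (1 : ℂ)) (g := 𝓕 (g : ℝ → ℂ)) Real.continuous_fourierChar
    (by simp only [LinearMap.neg_apply, innerₗ_apply_apply]; fun_prop) (integrable_const _) hFg
  have e2 := VectorFourier.integral_fourierIntegral_smul_eq_flip (μ := volume) (ν := volume)
    (L := innerₗ ℝ) (f := (g : ℝ → ℂ)) (g := scaledCF μ) Real.continuous_fourierChar
    (by simp only [innerₗ_apply_apply]; fun_prop) g.integrable (scaledCF_integrable μ hint)
  have hflip : (innerₗ ℝ).flip = innerₗ ℝ := by ext; simp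
  have hflip' : (-innerₗ ℝ).flip = -innerₗ ℝ := by ext; simp
  rw [hflip] at e2
  rw [hflip'] at e1
  simp only [← scaledCF_eq, smul_eq_mul, one_mul] at e1 e2
  calc ∫ x, g x ∂μ = ∫ x, 𝓕⁻ (𝓕 (g : ℝ → ℂ)) x ∂μ := by rw [hinv]
    _ = ∫ ξ, scaledCF μ ξ * 𝓕 (g : ℝ → ℂ) ξ := e1.symm
    _ = ∫ ξ, 𝓕 (g : ℝ → ℂ) ξ * scaledCF μ ξ := by simp_rw [mul_comm]
    _ = _ := e2

lemma charFun1_neg (μ : Measure ℝ) (t : ℝ) :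
    charFun1 μ (-t) = (starRingEnd ℂ) (charFun1 μ t) := by
  simp [charFun1, ← integral_conj, ← Complex.exp_conj]

lemma fourier_scaledCF_real (μ : Measure ℝ) (x : ℝ) :
    (((𝓕 (scaledCF μ) x).re : ℝ) : ℂ) = 𝓕 (scaledCF μ) x := by
  rw [← Complex.conj_eq_iff_re]
  rw [fourier_real_eq_integral_exp_smul, ← integral_conj, ← integral_neg_eq_self]
  congr 1 with v
  simp only [smul_eq_mul, scaledCF, map_mul, ← Complex.exp_conj, ← charFun1_neg,
    Complex.conj_ofReal, Complex.conj_I]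
  congr 2
  · push_cast; ring
  · ring

lemma continuous_fourier_scaledCF (μ : Measure ℝ)
    (hint : Integrable (fun t => charFun1 μ t) volume) : Continuous (𝓕 (scaledCF μ)) :=
  VectorFourier.fourierIntegral_continuous Real.continuous_fourierChar
    (by simp only [innerₗ_apply_apply]; fun_prop) (scaledCF_integrable μ hint)

/-- The density. -/
noncomputable def densF (μ : Measure ℝ) (x : ℝ) : ℝ := (𝓕 (scaledCF μ) x).re

lemma continuous_densF (μ : Measure ℝ)
    (hint : Integrable (fun t => charFun1 μ t) volume) : Continuous (densF μ) :=
  Complex.continuous_re.comp (continuous_fourier_scaledCF μ hint)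

lemma bump_identity (μ : Measure ℝ) [IsProbabilityMeasure μ]
    (hint : Integrable (fun t => charFun1 μ t) volume) {c : ℝ} (b : ContDiffBump c) :
    ∫ x, b x ∂μ = ∫ x, b x * densF μ x := by
  have hcs : HasCompactSupport (fun x => (b x : ℂ)) :=
    b.hasCompactSupport.comp_left (g := fun r : ℝ => (r : ℂ)) (by simp)
  have hcd : ContDiff ℝ (⊤ : ℕ∞) (fun x => (b x : ℂ)) :=
    Complex.ofRealCLM.contDiff.comp b.contDiff
  have h := parseval_schwartz μ hint (hcs.toSchwartzMap hcd)
  simp only [HasCompactSupport.toSchwartzMap_toFun] at h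
  have hre : ∀ x, 𝓕 (scaledCF μ) x = (densF μ x : ℂ) := fun x => (fourier_scaledCF_real μ x).symm
  simp_rw [hre, ← Complex.ofReal_mul] at h
  rw [integral_complex_ofReal, integral_complex_ofReal] at h
  exact_mod_cast h

lemma ball_identity (μ : Measure ℝ) [IsProbabilityMeasure μ]
    (hint : Integrable (fun t => charFun1 μ t) volume) (c r : ℝ) (hr : 0 < r) :
    μ.real (Metric.ball c r) = ∫ x in Metric.ball c r, densF μ x := by
  let b : ℕ → ContDiffBump c := fun n =>
    ⟨r * (1 - 1 / ((n : ℝ) + 2)), r, by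
      have : 1 / ((n : ℝ) + 2) < 1 := by
        rw [div_lt_one (by positivity)]; linarith [(Nat.cast_nonneg n : (0 : ℝ) ≤ n)]
      exact mul_pos hr (by linarith), by
      have : 0 < 1 / ((n : ℝ) + 2) := by positivity
      nlinarith⟩
  have hlim0 : Filter.Tendsto (fun n : ℕ => r * (1 - 1 / ((n : ℝ) + 2))) Filter.atTop (𝓝 r) := by
    have h1 : Filter.Tendsto (fun n : ℕ => 1 / ((n : ℝ) + 2)) Filter.atTop (𝓝 0) := by
      simp_rw [one_div]
      exact (tendsto_natCast_atTop_atTop.atTop_add tendsto_const_nhds).inv_tendsto_atTop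
    simpa using (h1.const_sub 1).const_mul r
  have hlim : ∀ x, Filter.Tendsto (fun n => b n x) Filter.atTop
      (𝓝 ((Metric.ball c r).indicator (fun _ => (1 : ℝ)) x)) := by
    intro x
    by_cases hx : x ∈ Metric.ball c r
    · rw [Set.indicator_of_mem hx]
      apply tendsto_const_nhds.congr'
      filter_upwards [hlim0.eventually (lt_mem_nhds (Metric.mem_ball.1 hx))] with n hn
      exact ((b n).one_of_mem_closedBall (Metric.mem_closedBall.2 hn.le)).symm
    · rw [Set.indicator_of_notMem hx]
      apply tendsto_const_nhds.congr
      intro n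
      exact ((b n).zero_of_le_dist (not_lt.1 hx)).symm
  have T1 : Filter.Tendsto (fun n => ∫ x, b n x ∂μ) Filter.atTop
      (𝓝 (∫ x, (Metric.ball c r).indicator (fun _ => (1 : ℝ)) x ∂μ)) := by
    apply tendsto_integral_of_dominated_convergence (fun _ => 1)
    · exact fun n => (b n).continuous.aestronglyMeasurable
    · exact integrable_const _
    · intro n
      filter_upwards with x
      rw [Real.norm_eq_abs, abs_of_nonneg (b n).nonneg]
      exact (b n).le_one
    · exact Filter.Eventually.of_forall hlim
  have T2 : Filter.Tendsto (fun n => ∫ x, b n x * densF μ x) Filter.atTop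
      (𝓝 (∫ x, (Metric.ball c r).indicator (fun _ => (1 : ℝ)) x * densF μ x)) := by
    apply tendsto_integral_of_dominated_convergence
      ((Metric.ball c r).indicator (fun x => |densF μ x|))
    · exact fun n => ((b n).continuous.mul (continuous_densF μ hint)).aestronglyMeasurable
    · rw [integrable_indicator_iff measurableSet_ball]
      exact ((continuous_densF μ hint).abs.continuousOn.integrableOn_compact
        (isCompact_closedBall c r)).mono_set Metric.ball_subset_closedBall
    · intro n
      filter_upwards with x
      by_cases hx : x ∈ Metric.ball c r
      · rw [Set.indicator_of_mem hx, norm_mul, Real.norm_eq_abs, abs_of_nonneg (b n).nonneg,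
          Real.norm_eq_abs]
        exact mul_le_of_le_one_left (abs_nonneg _) (b n).le_one
      · rw [Set.indicator_of_notMem hx, (b n).zero_of_le_dist (not_lt.1 hx)]
        simp
    · exact Filter.Eventually.of_forall fun x => (hlim x).mul_const _
  simp_rw [bump_identity μ hint] at T1
  have := tendsto_nhds_unique T1 T2
  rw [integral_indicator measurableSet_ball] at this
  simp only [← Set.indicator_mul_left, one_mul] at this
  rw [integral_indicator measurableSet_ball] at this
  simpa using this

lemma densF_nonneg (μ : Measure ℝ) [IsProbabilityMeasure μ]
    (hint : Integrable (fun t => charFun1 μ t) volume) (x : ℝ) : 0 ≤ densF μ x := by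
  by_contra! hx
  obtain ⟨r, hr, hball⟩ := Metric.eventually_nhds_iff_ball.1
    ((continuous_densF μ hint).continuousAt.eventually (gt_mem_nhds (show densF μ x < densF μ x / 2 by linarith)))
  have h1 := ball_identity μ hint x r hr
  have h2 : ∫ y in Metric.ball x r, densF μ y ≤ ∫ y in Metric.ball x r, densF μ x / 2 := by
    refine setIntegral_mono_on ?_ (integrableOn_const measure_ball_lt_top.ne) measurableSet_ball fun y hy => (hball y hy).le
    exact ((continuous_densF μ hint).continuousOn.integrableOn_compact
      (isCompact_closedBall x r)).mono_set Metric.ball_subset_closedBall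
  rw [setIntegral_const, smul_eq_mul, Real.volume_real_ball hr.le] at h2
  have h3 : 0 ≤ μ.real (Metric.ball x r) := measureReal_nonneg
  nlinarith

/-- If the characteristic function of a probability measure `μ` on `ℝ` is (absolutely)
integrable, then `μ` has a continuous probability density function `f` w.r.t. Lebesgue
measure, given by `f(x) = (1/(2π)) ∫ exp(-i t x) φ(t) dt`. -/
theorem density_from_integrable_charFun (μ : Measure ℝ) [IsProbabilityMeasure μ]
    (hint : Integrable (fun t => charFun1 μ t) volume) :
    ∃ f : ℝ → ℝ,
      Continuous f ∧
      (∀ x, 0 ≤ f x) ∧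
      (∀ x : ℝ, (f x : ℂ) =
        (1 / (2 * Real.pi) : ℂ) *
          ∫ t : ℝ, Complex.exp (-(((t * x : ℝ) : ℂ) * Complex.I)) * charFun1 μ t) ∧
      (∀ A : Set ℝ, MeasurableSet A → μ A = ENNReal.ofReal (∫ x in A, f x)) := by
  have hc := continuous_densF μ hint
  have hn := densF_nonneg μ hint
  refine ⟨densF μ, hc, hn, fun x => ?_, ?_⟩
  · rw [← fourier_scaledCF]; exact fourier_scaledCF_real μ x
  have hμ : μ = volume.withDensity (fun x => ENNReal.ofReal (densF μ x)) := by
    apply Real.measure_ext_Ioo_rat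
    intro a b
    rcases le_or_gt b a with hab | hab
    · have : Set.Ioo (a : ℝ) b = ∅ := Set.Ioo_eq_empty (not_lt.2 (by exact_mod_cast hab))
      simp [this]
    · have hab' : (a : ℝ) < b := by exact_mod_cast hab
      rw [withDensity_apply _ measurableSet_Ioo, Real.Ioo_eq_ball,
        ← ofReal_integral_eq_lintegral_ofReal _ (Filter.Eventually.of_forall hn),
        ← ball_identity μ hint _ _ (by linarith), ofReal_measureReal]
      exact hc.integrableOn_Icc.mono_set
        (by rw [← Real.Ioo_eq_ball]; exact Set.Ioo_subset_Icc_self)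
  intro A hA
  have hA2 : μ A = ∫⁻ x in A, ENNReal.ofReal (densF μ x) := by
    conv_lhs => rw [hμ]
    rw [withDensity_apply _ hA]
  rw [hA2, ofReal_integral_eq_lintegral_ofReal _ (Filter.Eventually.of_forall hn)]
  refine ⟨hc.aestronglyMeasurable, ?_⟩
  rw [hasFiniteIntegral_iff_ofReal (Filter.Eventually.of_forall hn), ← hA2]
  exact measure_lt_top μ A
end
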